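/- Let p ∈ ℝ[z_1,...,z_m] be real stable, let z ∈ ℝ^m be above all roots of p, and let δ > 0 and j ≤ m satisfy (2/δ)·Φ^j_p(z) + (Φ^j_p(z))² ≤ 1. Then z + δ·1_j is above all roots of p − ∂²_{z_j} p, and for every i ≤ m, Φ^i_{p − ∂²_{z_j} p}(z + δ·1_j) ≤ Φ^i_p(z). -/

import Mathlib

noncomputable section

/-- A polynomial `p ∈ ℝ[z_1,...,z_m]` is real stable if it has no root
`(z_1,...,z_m) ∈ ℂ^m` with `Im(z_i) > 0` for every `i`. -/
def RealStable {m : ℕ} (p : MvPolynomial (Fin m) ℝ) : Prop :=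
  ∀ z : Fin m → ℂ, (∀ i, 0 < (z i).im) → (MvPolynomial.aeval z) p ≠ 0

/-- `z ∈ ℝ^m` is above all roots of `p` if `p(z + t) > 0` for every `t ≥ 0`. -/
def AboveRoots {m : ℕ} (p : MvPolynomial (Fin m) ℝ) (z : Fin m → ℝ) : Prop :=
  ∀ t : Fin m → ℝ, (∀ i, 0 ≤ t i) → 0 < MvPolynomial.eval (z + t) p

/-- The barrier function `Φ^i_p(z) = (∂_{z_i} p)(z) / p(z)`. -/
def Phi {m : ℕ} (p : MvPolynomial (Fin m) ℝ) (i : Fin m) (z : Fin m → ℝ) : ℝ :=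
  MvPolynomial.eval z (MvPolynomial.pderiv i p) / MvPolynomial.eval z p

open Complex in
theorem sine_coeff (g : ℂ → ℂ) (hg : DifferentiableOn ℂ g (Metric.ball 0 1)) (n : ℕ) (hn : 1 ≤ n)
    (ρ : ℝ) (h0 : 0 < ρ) (h1 : ρ < 1) :
    ∫ θ in (0:ℝ)..2 * Real.pi, Real.sin (n * θ) * (g (circleMap 0 ρ θ)).im
      = Real.pi * ρ ^ n * (iteratedDeriv n g 0 / (n.factorial : ℂ)).re := by
  have hsub : Metric.closedBall (0:ℂ) ρ ⊆ Metric.ball 0 1 := Metric.closedBall_subset_ball h1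
  have hd : DifferentiableOn ℂ g (Metric.closedBall 0 ρ) := hg.mono hsub
  have hcont : Continuous fun θ : ℝ => g (circleMap 0 ρ θ) := by
    refine hg.continuousOn.comp_continuous (continuous_circleMap 0 ρ) fun θ => hsub ?_
    exact circleMap_mem_closedBall 0 h0.le θ
  have e1 := hd.circleIntegral_one_div_sub_center_pow_smul h0 n
  have e2 : (∮ z in C(0, ρ), z ^ (n-1) * g z) = 0 := by
    apply Complex.circleIntegral_eq_zero_of_differentiable_on_off_countable h0.le Set.countable_empty
    · exact (continuous_pow _).continuousOn.mul hd.continuousOn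
    · intro z hz
      have : DifferentiableAt ℂ g z := hg.differentiableAt
        (Metric.isOpen_ball.mem_nhds (hsub (Metric.ball_subset_closedBall hz.1)))
      fun_prop
  have hρ : (ρ : ℂ) ≠ 0 := by exact_mod_cast h0.ne'
  have key : ∫ θ in (0:ℝ)..2 * Real.pi, ((2 * Real.sin (n * θ) : ℝ) : ℂ) * g (circleMap 0 ρ θ)
      = (2 * Real.pi * I) * (ρ ^ n * (iteratedDeriv n g 0 / (n.factorial : ℂ))) := by
    have e3 : (∫ θ in (0:ℝ)..2 * Real.pi, ((2 * Real.sin (n * θ) : ℝ) : ℂ) * g (circleMap 0 ρ θ))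
        = ρ ^ n * (∮ z in C(0, ρ), (1 / (z - 0) ^ (n+1)) • g z)
          - ((ρ : ℂ) ^ n)⁻¹ * (∮ z in C(0, ρ), z ^ (n-1) * g z) := by
      unfold circleIntegral
      rw [← intervalIntegral.integral_const_mul, ← intervalIntegral.integral_const_mul,
        ← intervalIntegral.integral_sub]
      · refine intervalIntegral.integral_congr fun θ _ => ?_
        have hE : Complex.exp (θ * I) ≠ 0 := Complex.exp_ne_zero _
        obtain ⟨k, rfl⟩ : ∃ k, n = k + 1 := ⟨n - 1, by omega⟩
        simp only [deriv_circleMap, circleMap_zero, smul_eq_mul, sub_zero, Nat.add_sub_cancel]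
        have hs : ((2 * Real.sin ((k+1 : ℕ) * θ) : ℝ) : ℂ)
            = (((Complex.exp (θ * I)) ^ (k+1))⁻¹ - (Complex.exp (θ * I)) ^ (k+1)) * I := by
          push_cast
          rw [Complex.two_sin, ← Complex.exp_nat_mul, ← Complex.exp_neg]
          push_cast
          ring_nf
        rw [hs]
        generalize Complex.exp (θ * I) = E at *
        field_simp
        ring
      · apply Continuous.intervalIntegrable
        refine continuous_const.mul ?_
        simp only [deriv_circleMap, smul_eq_mul, sub_zero]
        have hc := continuous_circleMap 0 ρ
        refine (hc.mul continuous_const).mul (Continuous.mul ?_ hcont)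
        refine continuous_const.div (hc.pow _) fun θ => pow_ne_zero _ ?_
        simpa using h0.ne'
      · apply Continuous.intervalIntegrable
        refine continuous_const.mul ?_
        simp only [deriv_circleMap, smul_eq_mul]
        have hc := continuous_circleMap 0 ρ
        exact (hc.mul continuous_const).mul (Continuous.mul (hc.pow _) hcont)
    rw [e3, e1, e2]
    simp only [smul_eq_mul]
    ring
  have hii : IntervalIntegrable (fun θ : ℝ => ((2 * Real.sin (n * θ) : ℝ) : ℂ) * g (circleMap 0 ρ θ))
      MeasureTheory.volume 0 (2 * Real.pi) := by
    apply Continuous.intervalIntegrable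
    refine Continuous.mul ?_ hcont
    fun_prop
  have him := congrArg Complex.im key
  rw [← Complex.imCLM_apply, ← Complex.imCLM.intervalIntegral_comp_comm hii] at him
  simp only [Complex.imCLM_apply, Complex.im_ofReal_mul] at him
  have : (2 * (Real.pi:ℂ) * I * (ρ ^ n * (iteratedDeriv n g 0 / (n.factorial : ℂ)))).im
      = 2 * (Real.pi * ρ ^ n * (iteratedDeriv n g 0 / (n.factorial : ℂ)).re) := by
    rw [show 2 * (Real.pi:ℂ) * I * (ρ ^ n * (iteratedDeriv n g 0 / (n.factorial : ℂ)))
      = ((2 * Real.pi * ρ ^ n : ℝ) : ℂ) * ((iteratedDeriv n g 0 / (n.factorial : ℂ)) * I) by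
        push_cast; ring, Complex.im_ofReal_mul]
    simp
    ring
  rw [this] at him
  simp only [mul_assoc, intervalIntegral.integral_const_mul] at him ⊢
  linarith

theorem typically_real (g : ℂ → ℂ) (hg : DifferentiableOn ℂ g (Metric.ball 0 1))
    (hs : ∀ ζ ∈ Metric.ball (0:ℂ) 1, (g ζ).im * ζ.im ≤ 0) :
    (deriv g 0).re ≤ 0 ∧ 4 * (deriv g 0).re ≤ (deriv (deriv g) 0).re := by
  have key : ∀ ρ : ℝ, 0 < ρ → ρ < 1 → (deriv g 0).re ≤ 0 ∧
      4 * (deriv g 0).re ≤ ρ * (deriv (deriv g) 0).re := by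
    intro ρ h0 h1
    have hpi := Real.pi_pos
    have s1 := sine_coeff g hg 1 le_rfl ρ h0 h1
    have s2 := sine_coeff g hg 2 (by norm_num) ρ h0 h1
    have hsub : Metric.closedBall (0:ℂ) ρ ⊆ Metric.ball 0 1 := Metric.closedBall_subset_ball h1
    have hcont : Continuous fun θ : ℝ => g (circleMap 0 ρ θ) := by
      refine hg.continuousOn.comp_continuous (continuous_circleMap 0 ρ) fun θ => hsub ?_
      exact circleMap_mem_closedBall 0 h0.le θ
    have hcim := Complex.continuous_im.comp hcont
    have hsgn : ∀ θ : ℝ, Real.sin θ * (g (circleMap 0 ρ θ)).im ≤ 0 := by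
      intro θ
      have := hs _ (hsub (circleMap_mem_closedBall 0 h0.le θ))
      have e : (circleMap 0 ρ θ).im = ρ * Real.sin θ := by
        rw [circleMap_zero, Complex.im_ofReal_mul, Complex.exp_ofReal_mul_I_im]
      rw [e] at this
      by_contra hc
      push Not at hc
      nlinarith [mul_pos h0 hc]
    have i1 : (∫ θ in (0:ℝ)..2 * Real.pi, Real.sin ((1:ℕ) * θ) * (g (circleMap 0 ρ θ)).im) ≤ 0 := by
      have := intervalIntegral.integral_nonneg (μ := MeasureTheory.volume)
        (f := fun θ => -(Real.sin ((1:ℕ) * θ) * (g (circleMap 0 ρ θ)).im))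
        (a := 0) (b := 2 * Real.pi) (by positivity)
        (fun θ _ => by simpa using hsgn θ)
      rw [intervalIntegral.integral_neg] at this
      linarith
    have i2 : 0 ≤ (∫ θ in (0:ℝ)..2 * Real.pi, Real.sin ((2:ℕ) * θ) * (g (circleMap 0 ρ θ)).im)
        - 2 * (∫ θ in (0:ℝ)..2 * Real.pi, Real.sin ((1:ℕ) * θ) * (g (circleMap 0 ρ θ)).im) := by
      rw [← intervalIntegral.integral_const_mul, ← intervalIntegral.integral_sub]
      · refine intervalIntegral.integral_nonneg (by positivity) fun θ _ => ?_
        push_cast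
        rw [Real.sin_two_mul, one_mul]
        nlinarith [hsgn θ, Real.cos_le_one θ]
      · apply Continuous.intervalIntegrable
        exact Continuous.mul (by fun_prop) hcim
      · apply Continuous.intervalIntegrable
        exact continuous_const.mul (Continuous.mul (by fun_prop) hcim)
    rw [s1] at i1 i2
    rw [s2] at i2
    rw [iteratedDeriv_succ, iteratedDeriv_one] at i2
    rw [iteratedDeriv_one] at i1
    have hf2 : ((deriv (deriv g) 0) / ((Nat.factorial 2 : ℕ) : ℂ)).re = (deriv (deriv g) 0).re / 2 := by
      simp [Nat.factorial]
    rw [hf2] at i2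
    simp only [Nat.factorial, pow_one, Nat.cast_one, mul_one, div_one, Nat.succ_eq_add_one, zero_add] at i1 i2
    constructor
    · by_contra hc
      push Not at hc
      have := mul_pos (mul_pos hpi h0) hc
      linarith
    · have : 0 ≤ (Real.pi * ρ) * (ρ * (deriv (deriv g) 0).re / 2 - 2 * (deriv g 0).re) := by
        linarith
      have := nonneg_of_mul_nonneg_right this (mul_pos hpi h0)
      linarith
  refine ⟨(key (1/2) (by norm_num) (by norm_num)).1, ?_⟩
  have ht : Filter.Tendsto (fun ρ : ℝ => ρ * (deriv (deriv g) 0).re) (nhdsWithin 1 (Set.Iio 1))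
      (nhds (1 * (deriv (deriv g) 0).re)) :=
    (Continuous.tendsto (by fun_prop) 1).mono_left nhdsWithin_le_nhds
  rw [one_mul] at ht
  refine ge_of_tendsto ht ?_
  filter_upwards [Ioo_mem_nhdsLT (show (0:ℝ) < 1 by norm_num)] with ρ hρ
  exact (key ρ hρ.1 hρ.2).2

theorem slit_bound (h : ℂ → ℂ) (hd : DifferentiableOn ℂ h Complex.slitPlane)
    (hs : ∀ t ∈ Complex.slitPlane, (h t).im * t.im ≤ 0) (t₀ : ℝ) (ht₀ : 0 < t₀) :
    (deriv h t₀).re ≤ 0 ∧ 0 ≤ (deriv (deriv h) t₀).re := by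
  set V : ℂ → ℂ := fun ζ => (1 + ζ) / (1 - ζ) with hV
  set φ : ℂ → ℂ := fun ζ => t₀ * (V ζ) ^ 2 with hφ
  have hne : ∀ ζ ∈ Metric.ball (0:ℂ) 1, 1 - ζ ≠ 0 := by
    intro ζ hζ h0
    have : ζ = 1 := (sub_eq_zero.mp h0).symm
    subst this
    simp at hζ
  have hns : ∀ ζ ∈ Metric.ball (0:ℂ) 1, 0 < Complex.normSq (1 - ζ) := fun ζ hζ =>
    Complex.normSq_pos.mpr (hne ζ hζ)
  have hlt : ∀ ζ ∈ Metric.ball (0:ℂ) 1, ζ.re ^ 2 + ζ.im ^ 2 < 1 := by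
    intro ζ hζ
    rw [mem_ball_zero_iff] at hζ
    have := Complex.sq_norm ζ
    rw [Complex.normSq_apply] at this
    nlinarith [norm_nonneg ζ]
  have hVre : ∀ ζ ∈ Metric.ball (0:ℂ) 1,
      (V ζ).re = (1 - (ζ.re ^ 2 + ζ.im ^ 2)) / Complex.normSq (1 - ζ) := by
    intro ζ hζ
    simp only [hV, Complex.div_re]
    simp
    ring
  have hVim : ∀ ζ ∈ Metric.ball (0:ℂ) 1,
      (V ζ).im = 2 * ζ.im / Complex.normSq (1 - ζ) := by
    intro ζ hζ
    simp only [hV, Complex.div_im]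
    simp
    ring
  have hVpos : ∀ ζ ∈ Metric.ball (0:ℂ) 1, 0 < (V ζ).re := by
    intro ζ hζ
    rw [hVre ζ hζ]
    exact div_pos (by linarith [hlt ζ hζ]) (hns ζ hζ)
  have hφre : ∀ ζ, (φ ζ).re = t₀ * ((V ζ).re ^ 2 - (V ζ).im ^ 2) := by
    intro ζ
    simp only [hφ]
    rw [Complex.re_ofReal_mul, pow_two, Complex.mul_re]
    ring
  have hφim : ∀ ζ, (φ ζ).im = 2 * t₀ * (V ζ).re * (V ζ).im := by
    intro ζ
    simp only [hφ]
    rw [Complex.im_ofReal_mul, pow_two, Complex.mul_im]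
    ring
  have hmem : ∀ ζ ∈ Metric.ball (0:ℂ) 1, φ ζ ∈ Complex.slitPlane := by
    intro ζ hζ
    rw [Complex.mem_slitPlane_iff, hφre, hφim]
    have h1 := hVpos ζ hζ
    by_cases h2 : (V ζ).im = 0
    · left
      rw [h2, zero_pow two_ne_zero, sub_zero]
      positivity
    · right
      positivity
  have hφd : ∀ ζ ∈ Metric.ball (0:ℂ) 1,
      HasDerivAt φ (t₀ * (4 * (1 + ζ) / (1 - ζ) ^ 3)) ζ := by
    intro ζ hζ
    have h1 := hne ζ hζ
    have := ((((hasDerivAt_id' ζ).const_add 1).fun_div ((hasDerivAt_id' ζ).const_sub 1) h1).fun_pow 2).const_mul (t₀ : ℂ)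
    refine this.congr_deriv ?_
    push_cast
    field_simp
    ring
  have h0 : (0:ℂ) ∈ Metric.ball (0:ℂ) 1 := by simp
  have hφ0 : φ 0 = t₀ := by simp [hφ, hV]
  have hhd : ∀ t ∈ Complex.slitPlane, DifferentiableAt ℂ h t := fun t ht =>
    hd.differentiableAt (Complex.isOpen_slitPlane.mem_nhds ht)
  have hgd : ∀ ζ ∈ Metric.ball (0:ℂ) 1,
      HasDerivAt (h ∘ φ) (deriv h (φ ζ) * (t₀ * (4 * (1 + ζ) / (1 - ζ) ^ 3))) ζ := fun ζ hζ =>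
    (hhd _ (hmem ζ hζ)).hasDerivAt.comp ζ (hφd ζ hζ)
  have T := typically_real (h ∘ φ) (fun ζ hζ => (hgd ζ hζ).differentiableAt.differentiableWithinAt) (by
    intro ζ hζ
    have h1 := hs _ (hmem ζ hζ)
    rw [hφim, hVim ζ hζ] at h1
    have h2 := hVpos ζ hζ
    have h3 := hns ζ hζ
    have h4 : (h (φ ζ)).im * (2 * t₀ * (V ζ).re * (2 * ζ.im / Complex.normSq (1 - ζ)))
      = ((h (φ ζ)).im * ζ.im) * (2 * t₀ * (V ζ).re * (2 / Complex.normSq (1 - ζ))) := by ring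
    rw [h4] at h1
    by_contra hc
    push Not at hc
    have := mul_pos hc (show 0 < (2 * t₀ * (V ζ).re * (2 / Complex.normSq (1 - ζ))) by positivity)
    simp only [Function.comp] at this
    linarith)
  have d1 : deriv (h ∘ φ) 0 = ((4 * t₀ : ℝ) : ℂ) * deriv h t₀ := by
    rw [(hgd 0 h0).deriv, hφ0]
    push_cast
    ring
  have hh2 : DifferentiableAt ℂ (deriv h) t₀ :=
    (hd.deriv Complex.isOpen_slitPlane).differentiableAt
      (Complex.isOpen_slitPlane.mem_nhds (Complex.ofReal_mem_slitPlane.mpr ht₀))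
  have d2 : deriv (deriv (h ∘ φ)) 0
      = ((16 * t₀ ^ 2 : ℝ) : ℂ) * deriv (deriv h) t₀ + ((16 * t₀ : ℝ) : ℂ) * deriv h t₀ := by
    have he : deriv (h ∘ φ) =ᶠ[nhds 0]
        fun ζ => deriv h (φ ζ) * (t₀ * (4 * (1 + ζ) / (1 - ζ) ^ 3)) := by
      filter_upwards [Metric.isOpen_ball.mem_nhds h0] with ζ hζ
      exact (hgd ζ hζ).deriv
    rw [he.deriv_eq]
    have hr : HasDerivAt (fun ζ : ℂ => (t₀:ℂ) * (4 * (1 + ζ) / (1 - ζ) ^ 3)) (16 * (t₀:ℂ)) (0:ℂ) := by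
      have := (((((hasDerivAt_id' (0:ℂ)).const_add 1).const_mul (4:ℂ)).fun_div
        (((hasDerivAt_id' (0:ℂ)).const_sub 1).fun_pow 3) (by simp))).const_mul (t₀ : ℂ)
      refine this.congr_deriv ?_
      norm_num
      ring
    rw [← hφ0] at hh2
    have := (hh2.hasDerivAt.comp 0 (hφd 0 h0)).mul hr
    have h5 := this.deriv
    simp only [Function.comp_apply, hφ0] at h5
    refine Eq.trans h5 ?_
    push_cast
    ring
  rw [d1, d2] at T
  simp only [Complex.add_re, Complex.re_ofReal_mul] at T
  obtain ⟨T1, T2⟩ := T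
  constructor
  · by_contra hc
    push Not at hc
    have := mul_pos (show 0 < 4 * t₀ by positivity) hc
    linarith
  · have : 0 ≤ (16 * t₀ ^ 2) * (deriv (deriv h) t₀).re := by linarith
    exact nonneg_of_mul_nonneg_right this (by positivity)

open MvPolynomial

theorem line_differentiable {m : ℕ} (q : MvPolynomial (Fin m) ℝ) (x v : Fin m → ℂ) :
    Differentiable ℂ (fun t : ℂ => aeval (fun k => x k + t * v k) q) := by
  induction q using MvPolynomial.induction_on with
  | C a => simp
  | add p q hp hq => simp only [map_add]; exact hp.add hq
  | mul_X p n hp =>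
    simp only [map_mul, aeval_X]
    exact hp.mul (by fun_prop)

theorem line_hasDerivAt {m : ℕ} (q : MvPolynomial (Fin m) ℝ) (x : Fin m → ℂ) (j : Fin m) (t : ℂ) :
    HasDerivAt (fun t : ℂ => aeval (fun k => x k + t * (Pi.single j 1 : Fin m → ℂ) k) q)
      (aeval (fun k => x k + t * (Pi.single j 1 : Fin m → ℂ) k) (pderiv j q)) t := by
  induction q using MvPolynomial.induction_on with
  | C a => simpa using hasDerivAt_const t (a : ℂ)
  | add p q hp hq => simpa using hp.fun_add hq
  | mul_X p n hp =>
    simp only [map_mul, aeval_X, Derivation.leibniz, pderiv_X, map_add, smul_eq_mul]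
    have h1 : HasDerivAt (fun t : ℂ => x n + t * (Pi.single j 1 : Fin m → ℂ) n)
        ((Pi.single j 1 : Fin m → ℂ) n) t := by
      simpa using ((hasDerivAt_id' t).mul_const ((Pi.single j 1 : Fin m → ℂ) n)).const_add (x n)
    refine (hp.fun_mul h1).congr_deriv ?_
    rcases eq_or_ne n j with rfl | hne
    · simp
      ring
    · simp [Pi.single_apply, hne]
      ring

theorem aeval_continuous {m : ℕ} (q : MvPolynomial (Fin m) ℝ) :
    Continuous (fun x : Fin m → ℂ => aeval x q) := by
  induction q using MvPolynomial.induction_on with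
  | C a => simpa using continuous_const
  | add p q hp hq => simp only [map_add]; exact hp.add hq
  | mul_X p n hp =>
    simp only [map_mul, aeval_X]
    exact hp.mul (by fun_prop)

theorem aeval_conj {m : ℕ} (q : MvPolynomial (Fin m) ℝ) (x : Fin m → ℂ) :
    aeval (fun k => (starRingEnd ℂ) (x k)) q = (starRingEnd ℂ) (aeval x q) := by
  induction q using MvPolynomial.induction_on with
  | C a => simp
  | add p q hp hq => simp [hp, hq]
  | mul_X p n hp => simp [hp]

theorem aeval_real {m : ℕ} (q : MvPolynomial (Fin m) ℝ) (x : Fin m → ℝ) :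
    aeval (fun k => (x k : ℂ)) q = ((eval x q : ℝ) : ℂ) := by
  induction q using MvPolynomial.induction_on with
  | C a => simp
  | add p q hp hq => simp [hp, hq]
  | mul_X p n hp => simp [hp]

/-- restriction of `q` to a complex line, as a univariate polynomial -/
def linePoly {m : ℕ} (q : MvPolynomial (Fin m) ℝ) (x v : Fin m → ℂ) : Polynomial ℂ :=
  aeval (fun k => Polynomial.C (v k) * Polynomial.X + Polynomial.C (x k)) (map (algebraMap ℝ ℂ) q)

theorem linePoly_eval {m : ℕ} (q : MvPolynomial (Fin m) ℝ) (x v : Fin m → ℂ) (t : ℂ) :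
    (linePoly q x v).eval t = aeval (fun k => x k + t * v k) q := by
  unfold linePoly
  induction q using MvPolynomial.induction_on with
  | C a => simp
  | add p q hp hq => simp [hp, hq]
  | mul_X p n hp =>
    simp [hp]
    left
    ring

theorem linePoly_natDegree {m : ℕ} (q : MvPolynomial (Fin m) ℝ) (x v : Fin m → ℂ) :
    (linePoly q x v).natDegree ≤ q.totalDegree := by
  have := aeval_natDegree_le (m := q.totalDegree) (n := 1) (map (algebraMap ℝ ℂ) q)
    (Finset.sup_mono (support_map_subset _ _))
    (fun k => Polynomial.C (v k) * Polynomial.X + Polynomial.C (x k))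
    (fun k => Polynomial.natDegree_linear_le)
  simpa [linePoly] using this

theorem poly_lower (F : Polynomial ℂ) (n : ℕ) (hn : F.natDegree ≤ n)
    (hF : ∀ t : ℂ, 0 < t.im → F.eval t ≠ 0) (t : ℂ) (ht : 0 < t.im) :
    ‖F.eval 0‖ ≤ (1 + ‖t‖ / t.im) ^ n * ‖F.eval t‖ := by
  set K := 1 + ‖t‖ / t.im with hK
  have hK1 : 1 ≤ K := by
    have : 0 ≤ ‖t‖ / t.im := by positivity
    linarith
  have hs := IsAlgClosed.splits F
  have hroot : ∀ r ∈ F.roots, ‖0 - r‖ ≤ K * ‖t - r‖ := by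
    intro r hr
    have h1 : r.im ≤ 0 := by
      by_contra hc
      push Not at hc
      exact hF r hc (Polynomial.isRoot_of_mem_roots hr)
    have h2 : t.im ≤ ‖t - r‖ := by
      have := Complex.abs_im_le_norm (t - r)
      rw [Complex.sub_im] at this
      linarith [le_abs_self (t.im - r.im)]
    have h3 : ‖t‖ ≤ ‖t‖ / t.im * ‖t - r‖ := by
      calc ‖t‖ = ‖t‖ / t.im * t.im := by field_simp
        _ ≤ _ := by gcongr
    have h4 : ‖0 - r‖ ≤ ‖t - r‖ + ‖t‖ := by
      calc ‖0 - r‖ = ‖(t - r) - t‖ := by congr 1; ring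
        _ ≤ _ := norm_sub_le _ _
    rw [hK]
    linarith
  have hprod : ∀ s : Multiset ℂ, (∀ r ∈ s, ‖0 - r‖ ≤ K * ‖t - r‖) →
      ‖(s.map (fun r => 0 - r)).prod‖ ≤ K ^ (Multiset.card s) * ‖(s.map (fun r => t - r)).prod‖ := by
    intro s
    induction s using Multiset.induction_on with
    | empty => simp
    | cons a s ih =>
      intro h
      have h1 := h a (Multiset.mem_cons_self a s)
      have h2 := ih (fun r hr => h r (Multiset.mem_cons_of_mem hr))
      simp only [Multiset.map_cons, Multiset.prod_cons, norm_mul, Multiset.card_cons]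
      calc _ ≤ (K * ‖t - a‖) * (K ^ (Multiset.card s) * ‖(s.map (fun r => t - r)).prod‖) := by
            gcongr
        _ = _ := by ring
  rw [hs.eval_eq_prod_roots, hs.eval_eq_prod_roots, norm_mul, norm_mul]
  have h5 := hprod F.roots hroot
  have h6 : K ^ (Multiset.card F.roots) ≤ K ^ n :=
    pow_le_pow_right₀ hK1 ((Polynomial.card_roots' F).trans hn)
  calc _ ≤ ‖F.leadingCoeff‖ * (K ^ n * ‖(F.roots.map (fun r => t - r)).prod‖) := by
        gcongr
        exact h5.trans (by gcongr)
    _ = _ := by ring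

theorem stable_line {m : ℕ} (p : MvPolynomial (Fin m) ℝ) (hp : RealStable p)
    (x : Fin m → ℝ) (hx : eval x p ≠ 0) (v : Fin m → ℝ) (hv : ∀ k, 0 ≤ v k) (t : ℂ) (ht : 0 < t.im) :
    aeval (fun k => (x k : ℂ) + t * (v k : ℂ)) p ≠ 0 := by
  have key : ∀ ε : ℝ, 0 < ε →
      ‖aeval (fun k => (x k : ℂ) + (ε:ℂ) * Complex.I) p‖ ≤ (1 + ‖t‖ / t.im) ^ p.totalDegree *
        ‖aeval (fun k => ((x k : ℂ) + (ε:ℂ) * Complex.I) + t * (v k : ℂ)) p‖ := by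
    intro ε hε
    have := poly_lower (linePoly p (fun k => (x k : ℂ) + (ε:ℂ) * Complex.I) (fun k => (v k : ℂ)))
      _ (linePoly_natDegree p _ _) (by
        intro s hs
        rw [linePoly_eval]
        apply hp
        intro k
        have : 0 ≤ s.im * v k := mul_nonneg hs.le (hv k)
        simp
        linarith) t ht
    rw [linePoly_eval, linePoly_eval] at this
    simpa using this
  have lim1 : Filter.Tendsto (fun ε : ℝ => ‖aeval (fun k => (x k : ℂ) + (ε:ℂ) * Complex.I) p‖)
      (nhdsWithin 0 (Set.Ioi 0)) (nhds ‖aeval (fun k => (x k : ℂ)) p‖) := by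
    have hc : Continuous (fun ε : ℝ => ‖aeval (fun k => (x k : ℂ) + (ε:ℂ) * Complex.I) p‖) :=
      ((aeval_continuous p).comp (by fun_prop)).norm
    simpa using (hc.tendsto 0).mono_left nhdsWithin_le_nhds
  have lim2 : Filter.Tendsto (fun ε : ℝ => (1 + ‖t‖ / t.im) ^ p.totalDegree *
        ‖aeval (fun k => ((x k : ℂ) + (ε:ℂ) * Complex.I) + t * (v k : ℂ)) p‖)
      (nhdsWithin 0 (Set.Ioi 0)) (nhds ((1 + ‖t‖ / t.im) ^ p.totalDegree *
        ‖aeval (fun k => (x k : ℂ) + t * (v k : ℂ)) p‖)) := by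
    have hc : Continuous (fun ε : ℝ => (1 + ‖t‖ / t.im) ^ p.totalDegree *
        ‖aeval (fun k => ((x k : ℂ) + (ε:ℂ) * Complex.I) + t * (v k : ℂ)) p‖) :=
      continuous_const.mul ((aeval_continuous p).comp (by fun_prop)).norm
    simpa using (hc.tendsto 0).mono_left nhdsWithin_le_nhds
  have hle := le_of_tendsto_of_tendsto lim1 lim2
    (Filter.eventually_of_mem self_mem_nhdsWithin fun ε hε => key ε hε)
  intro h0
  rw [h0, aeval_real, norm_zero, mul_zero] at hle
  have : ((eval x p : ℝ) : ℂ) = 0 := norm_le_zero_iff.mp hle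
  exact hx (by exact_mod_cast this)

theorem linePoly_derivative {m : ℕ} (q : MvPolynomial (Fin m) ℝ) (x : Fin m → ℂ) (j : Fin m) (t : ℂ) :
    (linePoly q x (Pi.single j 1)).derivative.eval t
      = aeval (fun k => x k + t * (Pi.single j 1 : Fin m → ℂ) k) (pderiv j q) := by
  refine ((linePoly q x (Pi.single j 1)).hasDerivAt t).unique ?_
  have := line_hasDerivAt q x j t
  refine this.congr_of_eventuallyEq (Filter.Eventually.of_forall fun s => ?_)
  exact linePoly_eval q x _ s

theorem log_deriv_im {m : ℕ} (p : MvPolynomial (Fin m) ℝ) (hp : RealStable p) (i : Fin m)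
    (x : Fin m → ℂ) (hx : ∀ k, 0 < (x k).im) :
    (aeval x (pderiv i p) / aeval x p).im ≤ 0 := by
  have e1 := linePoly_derivative p x i 0
  have e2 := linePoly_eval p x (Pi.single i 1) 0
  simp only [zero_mul, add_zero] at e1 e2
  have hne := hp x hx
  rw [← e1, ← e2, (IsAlgClosed.splits _).eval_derivative_div_eval_of_ne_zero (by rw [e2]; exact hne)]
  have hsum : ∀ s : Multiset ℂ, (∀ r ∈ s, r.im ≤ 0) → ((s.map fun z => 1 / (0 - z)).sum).im ≤ 0 := by
    intro s
    induction s using Multiset.induction_on with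
    | empty => simp
    | cons a s ih =>
      intro h
      have h1 := h a (Multiset.mem_cons_self a s)
      have h2 := ih (fun r hr => h r (Multiset.mem_cons_of_mem hr))
      simp only [Multiset.map_cons, Multiset.sum_cons, Complex.add_im]
      have : (1 / (0 - a)).im ≤ 0 := by
        simp [Complex.inv_im]
        exact div_nonneg (neg_nonneg.mpr h1) (Complex.normSq_nonneg a)
      linarith
  apply hsum
  intro r hr
  by_contra hc
  push Not at hc
  have hroot := Polynomial.isRoot_of_mem_roots hr
  rw [Polynomial.IsRoot, linePoly_eval] at hroot
  refine hp _ (fun k => ?_) hroot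
  rcases eq_or_ne k i with rfl | hne
  · simpa using add_pos (hx k) hc
  · simpa [Pi.single_apply, hne] using hx k

theorem log_deriv_im_line {m : ℕ} (p : MvPolynomial (Fin m) ℝ) (hp : RealStable p) (i : Fin m)
    (x : Fin m → ℝ) (hx : eval x p ≠ 0) (v : Fin m → ℝ) (hv : ∀ k, 0 ≤ v k) (t : ℂ) (ht : 0 < t.im) :
    (aeval (fun k => (x k : ℂ) + t * (v k : ℂ)) (pderiv i p) /
      aeval (fun k => (x k : ℂ) + t * (v k : ℂ)) p).im ≤ 0 := by
  have hne := stable_line p hp x hx v hv t ht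
  have hc : ∀ q : MvPolynomial (Fin m) ℝ, Continuous
      (fun ε : ℝ => aeval (fun k => ((x k : ℂ) + t * (v k : ℂ)) + (ε:ℂ) * Complex.I) q) := fun q =>
      ((aeval_continuous q).comp (by fun_prop))
  have lim : Filter.Tendsto (fun ε : ℝ =>
      (aeval (fun k => ((x k : ℂ) + t * (v k : ℂ)) + (ε:ℂ) * Complex.I) (pderiv i p) /
       aeval (fun k => ((x k : ℂ) + t * (v k : ℂ)) + (ε:ℂ) * Complex.I) p).im)
      (nhdsWithin 0 (Set.Ioi 0)) (nhds ((aeval (fun k => (x k : ℂ) + t * (v k : ℂ)) (pderiv i p) /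
      aeval (fun k => (x k : ℂ) + t * (v k : ℂ)) p).im)) := by
    have h1 := (hc (pderiv i p)).tendsto 0
    have h2 := (hc p).tendsto 0
    simp only [Complex.ofReal_zero, zero_mul, add_zero] at h1 h2
    exact ((Complex.continuous_im.tendsto _).comp (h1.div h2 hne)).mono_left nhdsWithin_le_nhds
  refine le_of_tendsto lim (Filter.eventually_of_mem self_mem_nhdsWithin fun ε hε => ?_)
  refine log_deriv_im p hp i _ fun k => ?_
  have : 0 ≤ t.im * v k := mul_nonneg ht.le (hv k)
  have hε' : (0:ℝ) < ε := hε
  simp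
  linarith

theorem slit_tangent (h : ℂ → ℂ) (hd : DifferentiableOn ℂ h Complex.slitPlane)
    (hd0 : ContinuousAt h 0)
    (hs : ∀ t ∈ Complex.slitPlane, (h t).im * t.im ≤ 0) (δ : ℝ) (hδ : 0 < δ) :
    (h δ).re ≤ (h 0).re ∧ (h δ).re - δ * (deriv h δ).re ≤ (h 0).re := by
  have hmem : ∀ t : ℝ, 0 < t → (t : ℂ) ∈ Complex.slitPlane := fun t ht =>
    Complex.ofReal_mem_slitPlane.mpr ht
  have B := slit_bound h hd hs
  have hf : ∀ t : ℝ, 0 < t → HasDerivAt (fun s : ℝ => (h s).re) (deriv h t).re t := fun t ht =>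
    (hd.differentiableAt (Complex.isOpen_slitPlane.mem_nhds (hmem t ht))).hasDerivAt.real_of_complex
  have hf2 : ∀ t : ℝ, 0 < t →
      HasDerivAt (fun s : ℝ => (deriv h s).re) (deriv (deriv h) t).re t := fun t ht =>
    ((hd.deriv Complex.isOpen_slitPlane).differentiableAt
      (Complex.isOpen_slitPlane.mem_nhds (hmem t ht))).hasDerivAt.real_of_complex
  have hcont : ContinuousOn (fun s : ℝ => (h s).re) (Set.Icc 0 δ) := by
    intro s hs
    rcases hs.1.eq_or_lt with rfl | h0
    · refine ContinuousAt.continuousWithinAt ?_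
      have h1 : ContinuousAt h ((0:ℝ) : ℂ) := by simpa using hd0
      exact Complex.continuous_re.continuousAt.comp
        (ContinuousAt.comp h1 Complex.continuous_ofReal.continuousAt)
    · exact (hf s h0).continuousAt.continuousWithinAt
  have hmono : MonotoneOn (fun s : ℝ => (deriv h s).re) (Set.Ioi 0) := by
    refine monotoneOn_of_deriv_nonneg (convex_Ioi 0)
      (fun t ht => (hf2 t ht).continuousAt.continuousWithinAt) ?_ ?_
    · rw [interior_Ioi]
      exact fun t ht => (hf2 t ht).differentiableAt.differentiableWithinAt
    · rw [interior_Ioi]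
      intro t ht
      rw [(hf2 t ht).deriv]
      exact (B t ht).2
  have A : ∀ c : ℝ, (∀ t : ℝ, 0 < t → t < δ → (deriv h t).re ≤ c) → (h δ).re - δ * c ≤ (h 0).re := by
    intro c hc
    have hu : ∀ t : ℝ, 0 < t → HasDerivAt (fun s : ℝ => (h s).re - s * c) ((deriv h t).re - c) t :=
      fun t ht => by simpa using (hf t ht).fun_sub ((hasDerivAt_id' t).mul_const c)
    have : AntitoneOn (fun s : ℝ => (h s).re - s * c) (Set.Icc 0 δ) := by
      refine antitoneOn_of_deriv_nonpos (convex_Icc 0 δ) (hcont.sub (by fun_prop)) ?_ ?_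
      · rw [interior_Icc]
        exact fun t ht => (hu t ht.1).differentiableAt.differentiableWithinAt
      · rw [interior_Icc]
        intro t ht
        rw [(hu t ht.1).deriv]
        linarith [hc t ht.1 ht.2]
    have := this (Set.left_mem_Icc.mpr hδ.le) (Set.right_mem_Icc.mpr hδ.le) hδ.le
    simpa using this
  constructor
  · simpa using A 0 (fun t ht _ => (B t ht).1)
  · exact A _ (fun t ht htδ => hmono ht hδ htδ.le)

/-- barrier function restricted to a complex line -/
def phiLine {m : ℕ} (p : MvPolynomial (Fin m) ℝ) (i : Fin m) (x v : Fin m → ℝ) (t : ℂ) : ℂ :=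
  aeval (fun k => (x k : ℂ) + t * (v k : ℂ)) (pderiv i p) /
      aeval (fun k => (x k : ℂ) + t * (v k : ℂ)) p

theorem aeval_line_real {m : ℕ} (q : MvPolynomial (Fin m) ℝ) (x v : Fin m → ℝ) (t : ℝ) :
    aeval (fun k => (x k : ℂ) + (t : ℂ) * (v k : ℂ)) q = ((eval (x + t • v) q : ℝ) : ℂ) := by
  rw [← aeval_real]
  congr 2
  funext k
  simp

theorem phiLine_real {m : ℕ} (p : MvPolynomial (Fin m) ℝ) (i : Fin m) (x v : Fin m → ℝ) (t : ℝ) :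
    phiLine p i x v t = ((Phi p i (x + t • v) : ℝ) : ℂ) := by
  rw [phiLine, aeval_line_real, aeval_line_real, Phi, Complex.ofReal_div]

theorem aeval_line_conj {m : ℕ} (q : MvPolynomial (Fin m) ℝ) (x v : Fin m → ℝ) (t : ℂ) :
    aeval (fun k => (x k : ℂ) + (starRingEnd ℂ t) * (v k : ℂ)) q =
      starRingEnd ℂ (aeval (fun k => (x k : ℂ) + t * (v k : ℂ)) q) := by
  rw [← aeval_conj]
  congr 2
  funext k
  simp


theorem line_ne_zero {m : ℕ} (p : MvPolynomial (Fin m) ℝ) (hp : RealStable p) (x : Fin m → ℝ)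
    (hx : AboveRoots p x) (v : Fin m → ℝ) (hv : ∀ k, 0 ≤ v k) (t : ℂ) (ht : t ∈ Complex.slitPlane ∨ t = 0) :
    aeval (fun k => (x k : ℂ) + t * (v k : ℂ)) p ≠ 0 := by
  have hx0 : eval x p ≠ 0 := by
    have := hx 0 (fun _ => le_rfl)
    rw [add_zero] at this
    exact this.ne'
  rcases lt_trichotomy t.im 0 with h | h | h
  · have := stable_line p hp x hx0 v hv (starRingEnd ℂ t) (by simpa using h)
    rw [aeval_line_conj] at this
    intro h0
    rw [h0, map_zero] at this
    exact this rfl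
  · have hre : 0 ≤ t.re := by
      rcases ht with ht | ht
      · rcases Complex.mem_slitPlane_iff.mp ht with h1 | h1
        · exact h1.le
        · exact absurd h h1
      · simp [ht]
    have ht' : t = ((t.re : ℝ) : ℂ) := Complex.ext (by simp) (by simpa using h)
    rw [ht', aeval_line_real]
    have := hx (t.re • v) (fun k => by simpa using mul_nonneg hre (hv k))
    exact_mod_cast this.ne'
  · exact stable_line p hp x hx0 v hv t h

theorem phiLine_sign {m : ℕ} (p : MvPolynomial (Fin m) ℝ) (hp : RealStable p) (x : Fin m → ℝ)
    (hx : AboveRoots p x) (v : Fin m → ℝ) (hv : ∀ k, 0 ≤ v k) (i : Fin m) (t : ℂ) : (phiLine p i x v t).im * t.im ≤ 0 := by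
  have hx0 : eval x p ≠ 0 := by
    have := hx 0 (fun _ => le_rfl)
    rw [add_zero] at this
    exact this.ne'
  rcases lt_trichotomy t.im 0 with h | h | h
  · have := log_deriv_im_line p hp i x hx0 v hv (starRingEnd ℂ t) (by simpa using h)
    rw [aeval_line_conj, aeval_line_conj, ← map_div₀, Complex.conj_im] at this
    refine mul_nonpos_of_nonneg_of_nonpos ?_ h.le
    rw [phiLine]
    linarith
  · simp [h]
  · exact mul_nonpos_of_nonpos_of_nonneg (log_deriv_im_line p hp i x hx0 v hv t h) h.le

theorem phiLine_diffAt {m : ℕ} (p : MvPolynomial (Fin m) ℝ) (hp : RealStable p) (x : Fin m → ℝ)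
    (hx : AboveRoots p x) (v : Fin m → ℝ) (hv : ∀ k, 0 ≤ v k) (i : Fin m) (t : ℂ) (ht : t ∈ Complex.slitPlane ∨ t = 0) :
    DifferentiableAt ℂ (phiLine p i x v) t :=
  (line_differentiable _ _ _ t).div (line_differentiable _ _ _ t) (line_ne_zero p hp x hx v hv t ht)

theorem phiLine_diffOn {m : ℕ} (p : MvPolynomial (Fin m) ℝ) (hp : RealStable p) (x : Fin m → ℝ)
    (hx : AboveRoots p x) (v : Fin m → ℝ) (hv : ∀ k, 0 ≤ v k) (i : Fin m) : DifferentiableOn ℂ (phiLine p i x v) Complex.slitPlane :=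
  fun t ht => (phiLine_diffAt p hp x hx v hv i t (Or.inl ht)).differentiableWithinAt

theorem Phi_anti {m : ℕ} (p : MvPolynomial (Fin m) ℝ) (hp : RealStable p) (x : Fin m → ℝ)
    (hx : AboveRoots p x) (v : Fin m → ℝ) (hv : ∀ k, 0 ≤ v k) (i : Fin m) : Phi p i (x + v) ≤ Phi p i x := by
  have := (slit_tangent (phiLine p i x v) (phiLine_diffOn p hp x hx v hv i)
    (phiLine_diffAt p hp x hx v hv i 0 (Or.inr rfl)).continuousAt
    (fun t _ => phiLine_sign p hp x hx v hv i t) 1 one_pos).1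
  have e0 := phiLine_real p i x v 0
  simp only [Complex.ofReal_zero, zero_smul, add_zero] at e0
  rw [phiLine_real, e0] at this
  simpa using this

theorem Phi_nonneg {m : ℕ} (p : MvPolynomial (Fin m) ℝ) (hp : RealStable p) (x : Fin m → ℝ)
    (hx : AboveRoots p x) (i : Fin m) : 0 ≤ Phi p i x := by
  have e1 := linePoly_derivative p (fun k => (x k : ℂ)) i 0
  have e2 := linePoly_eval p (fun k => (x k : ℂ)) (Pi.single i 1) 0
  simp only [zero_mul, add_zero] at e1 e2
  have hv : ∀ k, (0:ℝ) ≤ (Pi.single i 1 : Fin m → ℝ) k := by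
    intro k
    rcases eq_or_ne k i with rfl | hne
    · simp
    · simp [hne]
  have hcast : ∀ k, (((Pi.single i 1 : Fin m → ℝ) k : ℝ) : ℂ) = (Pi.single i 1 : Fin m → ℂ) k := by
    intro k
    rcases eq_or_ne k i with rfl | hne
    · simp
    · simp [hne]
  have hnz := line_ne_zero p hp x hx _ hv
  simp only [hcast] at hnz
  have h0 := hnz 0 (Or.inr rfl)
  simp only [zero_mul, add_zero] at h0
  have e3 := (IsAlgClosed.splits (linePoly p (fun k => (x k : ℂ)) (Pi.single i 1))).eval_derivative_div_eval_of_ne_zero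
    (x := 0) (by rw [e2]; exact h0)
  rw [e1, e2, aeval_real, aeval_real, ← Complex.ofReal_div] at e3
  have e4 := congrArg Complex.re e3
  rw [Complex.ofReal_re] at e4
  rw [Phi, e4]
  have hsum : ∀ s : Multiset ℂ, (∀ r ∈ s, r.re ≤ 0) → 0 ≤ ((s.map fun z => 1 / (0 - z)).sum).re := by
    intro s
    induction s using Multiset.induction_on with
    | empty => simp
    | cons a s ih =>
      intro h
      have h1 := h a (Multiset.mem_cons_self a s)
      have h2 := ih (fun r hr => h r (Multiset.mem_cons_of_mem hr))
      simp only [Multiset.map_cons, Multiset.sum_cons, Complex.add_re]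
      have : 0 ≤ (1 / (0 - a)).re := by
        rw [zero_sub, one_div, Complex.inv_re, Complex.neg_re]
        exact div_nonneg (by linarith) (Complex.normSq_nonneg _)
      linarith
  apply hsum
  intro r hr
  by_contra hc
  push Not at hc
  have hroot := Polynomial.isRoot_of_mem_roots hr
  rw [Polynomial.IsRoot, linePoly_eval] at hroot
  exact hnz r (Or.inl (Complex.mem_slitPlane_iff.mpr (Or.inl hc))) hroot

theorem pderiv_swap {m : ℕ} (p : MvPolynomial (Fin m) ℝ) (i j : Fin m) :
    pderiv i (pderiv j p) = pderiv j (pderiv i p) := by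
  induction p using MvPolynomial.induction_on with
  | C a => simp
  | add p q hp hq => simp [hp, hq]
  | mul_X p n hp =>
    have hs' : ∀ a b : Fin m,
        pderiv a ((Pi.single b 1 : Fin m → MvPolynomial (Fin m) ℝ) n) = 0 := by
      intro a b
      rcases eq_or_ne n b with rfl | hne
      · simp
      · simp [hne]
    simp only [Derivation.leibniz, pderiv_X, map_add, smul_eq_mul, hp, hs']
    ring

/-- derivative data at `w = x + δ e_j` -/
theorem deriv_data {m : ℕ} (p : MvPolynomial (Fin m) ℝ) (hp : RealStable p) (x : Fin m → ℝ)
    (hx : AboveRoots p x) (i j : Fin m) (δ : ℝ) (hδ : 0 < δ)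
    (D A Dj Aj Djj Ajj : ℝ) (w : Fin m → ℝ) (hw : w = x + δ • (Pi.single j 1 : Fin m → ℝ))
    (hD : D = eval w p) (hA : A = eval w (pderiv i p))
    (hDj : Dj = eval w (pderiv j p)) (hAj : Aj = eval w (pderiv j (pderiv i p)))
    (hDjj : Djj = eval w (pderiv j (pderiv j p)))
    (hAjj : Ajj = eval w (pderiv j (pderiv j (pderiv i p)))) :
    0 < D ∧ (Aj * D - A * Dj) / D ^ 2 ≤ 0 ∧
    0 ≤ ((Ajj * D - A * Djj) * D ^ 2 - (Aj * D - A * Dj) * (2 * D * Dj)) / (D ^ 2) ^ 2 ∧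
    A / D - δ * ((Aj * D - A * Dj) / D ^ 2) ≤ Phi p i x := by
  set v : Fin m → ℝ := Pi.single j 1 with hvdef
  have hv : ∀ k, (0:ℝ) ≤ v k := by
    intro k
    rcases eq_or_ne k j with rfl | hne
    · simp [hvdef]
    · simp [hvdef, hne]
  have hcast : ∀ k, ((v k : ℝ) : ℂ) = (Pi.single j 1 : Fin m → ℂ) k := by
    intro k
    rcases eq_or_ne k j with rfl | hne
    · simp [hvdef]
    · simp [hvdef, hne]
  have hDpos : 0 < D := by
    rw [hD, hw]
    exact hx (δ • v) (fun k => by simpa using mul_nonneg hδ.le (hv k))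
  -- line evaluation
  let L : MvPolynomial (Fin m) ℝ → ℂ → ℂ := fun q t => aeval (fun k => (x k : ℂ) + t * (v k : ℂ)) q
  have hL : ∀ q t, HasDerivAt (L q) (L (pderiv j q) t) t := by
    intro q t
    have := line_hasDerivAt q (fun k => (x k : ℂ)) j t
    simpa only [L, hcast] using this
  have hLr : ∀ q, L q (δ : ℂ) = ((eval w q : ℝ) : ℂ) := by
    intro q
    rw [hw]
    exact aeval_line_real q x v δ
  have hne : ∀ t ∈ Complex.slitPlane, L p t ≠ 0 := fun t ht =>
    line_ne_zero p hp x hx v hv t (Or.inl ht)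
  have h1 : ∀ t ∈ Complex.slitPlane, HasDerivAt (phiLine p i x v)
      ((L (pderiv j (pderiv i p)) t * L p t - L (pderiv i p) t * L (pderiv j p) t) / L p t ^ 2) t :=
    fun t ht => (hL (pderiv i p) t).fun_div (hL p t) (hne t ht)
  have hδm : (δ : ℂ) ∈ Complex.slitPlane := Complex.ofReal_mem_slitPlane.mpr hδ
  have h2 : HasDerivAt (deriv (phiLine p i x v))
      (((((Ajj * D - A * Djj) * D ^ 2 - (Aj * D - A * Dj) * (2 * D * Dj)) / (D ^ 2) ^ 2 : ℝ)) : ℂ) δ := by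
    have he : deriv (phiLine p i x v) =ᶠ[nhds (δ:ℂ)] fun t =>
        (L (pderiv j (pderiv i p)) t * L p t - L (pderiv i p) t * L (pderiv j p) t) / L p t ^ 2 := by
      filter_upwards [Complex.isOpen_slitPlane.mem_nhds hδm] with t ht
      exact (h1 t ht).deriv
    refine HasDerivAt.congr_of_eventuallyEq ?_ he
    have := (((hL (pderiv j (pderiv i p)) δ).fun_mul (hL p δ)).fun_sub
      ((hL (pderiv i p) δ).fun_mul (hL (pderiv j p) δ))).fun_div ((hL p δ).fun_pow 2)
      (pow_ne_zero 2 (hne δ hδm))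
    refine this.congr_deriv ?_
    simp only [hLr, ← hD, ← hA, ← hDj, ← hAj, ← hDjj, ← hAjj]
    push_cast
    ring
  have hd1 : deriv (phiLine p i x v) δ = (((Aj * D - A * Dj) / D ^ 2 : ℝ) : ℂ) := by
    rw [(h1 δ hδm).deriv]
    simp only [hLr, ← hD, ← hA, ← hDj, ← hAj]
    push_cast
    ring
  have B := slit_bound (phiLine p i x v) (phiLine_diffOn p hp x hx v hv i)
    (fun t _ => phiLine_sign p hp x hx v hv i t) δ hδ
  have T := (slit_tangent (phiLine p i x v) (phiLine_diffOn p hp x hx v hv i)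
    (phiLine_diffAt p hp x hx v hv i 0 (Or.inr rfl)).continuousAt
    (fun t _ => phiLine_sign p hp x hx v hv i t) δ hδ).2
  have e0 := phiLine_real p i x v 0
  simp only [Complex.ofReal_zero, zero_smul, add_zero] at e0
  rw [phiLine_real, e0, hd1, Complex.ofReal_re, Complex.ofReal_re, Complex.ofReal_re] at T
  rw [h2.deriv, hd1, Complex.ofReal_re, Complex.ofReal_re] at B
  refine ⟨hDpos, B.1, B.2, ?_⟩
  rw [Phi, ← hw, ← hA, ← hD] at T
  exact T

theorem AboveRoots.translate {m : ℕ} {p : MvPolynomial (Fin m) ℝ} {x : Fin m → ℝ}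
    (hx : AboveRoots p x) (s : Fin m → ℝ) (hs : ∀ k, 0 ≤ s k) : AboveRoots p (x + s) := by
  intro t ht
  rw [add_assoc]
  exact hx (s + t) (fun k => add_nonneg (hs k) (ht k))

theorem final_arith (D A Dj Aj Djj Ajj δ P b : ℝ) (hδ : 0 < δ) (hD : 0 < D)
    (h1 : (Aj * D - A * Dj) / D ^ 2 ≤ 0)
    (h2 : 0 ≤ ((Ajj * D - A * Djj) * D ^ 2 - (Aj * D - A * Dj) * (2 * D * Dj)) / (D ^ 2) ^ 2)
    (h3 : A / D - δ * ((Aj * D - A * Dj) / D ^ 2) ≤ P)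
    (hb : b = Dj / D) (hbar : 2 / δ * b + b ^ 2 ≤ 1) (hc : Djj / D ≤ b ^ 2)
    (hq : 0 < D - Djj) : (A - Ajj) / (D - Djj) ≤ P := by
  refine le_trans ?_ h3
  obtain ⟨a, rfl⟩ : ∃ a, A = a * D := ⟨A / D, by field_simp⟩
  obtain ⟨d, rfl⟩ : ∃ a, Aj = a * D := ⟨Aj / D, by field_simp⟩
  obtain ⟨c, rfl⟩ : ∃ a, Djj = a * D := ⟨Djj / D, by field_simp⟩
  obtain ⟨e, rfl⟩ : ∃ a, Ajj = a * D := ⟨Ajj / D, by field_simp⟩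
  obtain ⟨b', rfl⟩ : ∃ a, Dj = a * D := ⟨Dj / D, by field_simp⟩
  have hbb : b = b' := by rw [hb]; field_simp
  subst hbb
  have r1 : (d * D * D - a * D * (b * D)) / D ^ 2 = d - a * b := by field_simp
  have r2 : ((e * D * D - a * D * (c * D)) * D ^ 2 - (d * D * D - a * D * (b * D)) * (2 * D * (b * D))) /
      (D ^ 2) ^ 2 = e - a * c - 2 * b * (d - a * b) := by field_simp
  have r3 : c * D / D = c := by field_simp
  have r4 : a * D / D = a := by field_simp
  have r5 : (a * D - e * D) / (D - c * D) = (a - e) / (1 - c) := by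
    rw [← sub_mul, show D - c * D = (1 - c) * D by ring, mul_div_mul_right _ _ hD.ne']
  rw [r1] at h1 ⊢
  rw [r2] at h2
  rw [r3] at hc
  rw [r4, r5]
  have hq' : 0 < 1 - c := by
    have : 0 < (1 - c) * D := by linarith
    exact pos_of_mul_pos_left this hD.le
  rw [div_le_iff₀ hq']
  have h5 : 2 * b ≤ δ * (1 - c) := by
    have : 2 / δ * b ≤ 1 - c := by linarith
    calc 2 * b = δ * (2 / δ * b) := by field_simp
      _ ≤ _ := by gcongr
  nlinarith [mul_nonneg (neg_nonneg.mpr h1) (sub_nonneg.mpr h5)]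

theorem stmt17 {m : ℕ} (p : MvPolynomial (Fin m) ℝ) (hp : RealStable p)
    (z : Fin m → ℝ) (hz : AboveRoots p z) (j : Fin m) (δ : ℝ) (hδ : 0 < δ)
    (hbar : 2 / δ * Phi p j z + (Phi p j z) ^ 2 ≤ 1) :
    AboveRoots (p - MvPolynomial.pderiv j (MvPolynomial.pderiv j p))
        (z + δ • (Pi.single j 1 : Fin m → ℝ)) ∧
      ∀ i : Fin m,
        Phi (p - MvPolynomial.pderiv j (MvPolynomial.pderiv j p)) i
            (z + δ • (Pi.single j 1 : Fin m → ℝ)) ≤ Phi p i z := by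
  have hv : ∀ k, (0:ℝ) ≤ (δ • (Pi.single j 1 : Fin m → ℝ)) k := by
    intro k
    rcases eq_or_ne k j with rfl | hne
    · simpa using hδ.le
    · simp [hne]
  have hΦ0 := Phi_nonneg p hp z hz j
  have hΦ1 : (Phi p j z) ^ 2 < 1 := by
    rcases hΦ0.eq_or_lt with h | h
    · rw [← h]; norm_num
    · have : 0 < 2 / δ * Phi p j z := by positivity
      linarith
  have hmain : ∀ s : Fin m → ℝ, (∀ k, 0 ≤ s k) → ∀ w, w = z + s + δ • (Pi.single j 1 : Fin m → ℝ) →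
      0 ≤ Phi p j w ∧ Phi p j w ≤ Phi p j z ∧
      eval w (pderiv j (pderiv j p)) / eval w p ≤ (Phi p j w) ^ 2 ∧
      0 < eval w p - eval w (pderiv j (pderiv j p)) := by
    intro s hs w hw
    have hzs := hz.translate s hs
    obtain ⟨hD, h1, -, -⟩ := deriv_data p hp (z + s) hzs j j δ hδ _ _ _ _ _ _ w hw rfl rfl rfl rfl rfl rfl
    have ha : 0 ≤ Phi p j w := by
      rw [hw]
      exact Phi_nonneg p hp _ (hzs.translate _ hv) j
    have hb : Phi p j w ≤ Phi p j z := by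
      rw [hw, add_assoc]
      exact Phi_anti p hp z hz _ (fun k => add_nonneg (hs k) (hv k)) j
    have hc : eval w (pderiv j (pderiv j p)) / eval w p ≤ (Phi p j w) ^ 2 := by
      rw [Phi]
      have : eval w (pderiv j (pderiv j p)) / eval w p - (eval w (pderiv j p) / eval w p) ^ 2
        = (eval w (pderiv j (pderiv j p)) * eval w p - eval w (pderiv j p) * eval w (pderiv j p)) /
          eval w p ^ 2 := by
        field_simp
      linarith
    refine ⟨ha, hb, hc, ?_⟩
    have : eval w (pderiv j (pderiv j p)) / eval w p < 1 := by
      have : (Phi p j w) ^ 2 ≤ (Phi p j z) ^ 2 := by gcongr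
      linarith
    rw [div_lt_one hD] at this
    linarith
  refine ⟨?_, ?_⟩
  · intro s hs
    have := (hmain s hs _ rfl).2.2.2
    rw [map_sub, add_right_comm]
    exact this
  · intro i
    obtain ⟨ha, hb, hc, hd⟩ := hmain 0 (fun _ => le_rfl) (z + δ • (Pi.single j 1 : Fin m → ℝ)) (by simp)
    obtain ⟨hD, h1, h2, h3⟩ := deriv_data p hp z hz i j δ hδ _ _ _ _ _ _ _ rfl rfl rfl rfl rfl rfl rfl
    rw [Phi, map_sub, map_sub, map_sub, pderiv_swap (pderiv j p) i j, pderiv_swap p i j]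
    refine final_arith _ _ _ _ _ _ δ _ _ hδ hD h1 h2 h3 rfl ?_ hc hd
    refine le_trans ?_ hbar
    change 2 / δ * Phi p j _ + (Phi p j _) ^ 2 ≤ _
    gcongr
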